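/- For every p ∈ (1,∞), the uncentred triangular maximal operator 𝒰 satisfies the weak-type (p,p) estimate |{x : 𝒰f(x) > α}| ≤ A_{p'}^p ‖f‖_p^p / α^p for all α > 0 and f ∈ L^p(𝔗), where A_{p'} = 4^{1/p'} (∑_{k=1}^∞ k^{p'} 2^{−k})^{1/p'} and p' is the conjugate exponent. Consequently, 𝒰 is bounded on L^p(𝔗) for every p ∈ (1, ∞]. -/

import Mathlib

open scoped ENNReal NNReal
open Set

/-- A locally finite tree presented via the data induced by a fixed geodesic ray `ω`:
a predecessor map `pred`, a height (Busemann) function `ht` increasing by one along `pred`,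
finite successor sets, and connectedness (any two vertices have a common ancestor). -/
structure TreeData (V : Type*) where
  pred : V → V
  ht : V → ℤ
  ht_pred : ∀ x, ht (pred x) = ht x + 1
  fiber_finite : ∀ x, {y | pred y = x}.Finite
  connected : ∀ x y, ∃ k l : ℕ, pred^[k] x = pred^[l] y

namespace TreeData

variable {V : Type*}

/-- The set of successors of a vertex. -/
def succs (t : TreeData V) (x : V) : Set V := {y | t.pred y = x}

/-- Every vertex has at least 3 neighbours, i.e. at least 2 successors. -/
def Thick (t : TreeData V) : Prop := ∀ x, 2 ≤ (t.succs x).ncard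

/-- Homogeneous tree `𝔗_b`: every vertex has exactly `b+1` neighbours, i.e. `b` successors. -/
def Homog (t : TreeData V) (b : ℕ) : Prop := ∀ x, (t.succs x).ncard = b

/-- The triangle with vertex `x` and height `R`: all descendants of `x` within `R` generations. -/
def tri (t : TreeData V) (x : V) (R : ℕ) : Set V := {y | ∃ j ≤ R, t.pred^[j] y = x}

/-- The base of the triangle with vertex `x` and height `R`: the `R`-fold successors of `x`. -/
def base (t : TreeData V) (x : V) (R : ℕ) : Set V := {y | t.pred^[R] y = x}

/-- The graph distance on the tree. -/
noncomputable def dist (t : TreeData V) (x y : V) : ℕ :=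
  sInf {n | ∃ k l : ℕ, k + l = n ∧ t.pred^[k] x = t.pred^[l] y}

/-- Number of points of a set, as an element of `ℝ≥0∞` (counting measure). -/
noncomputable def esize (E : Set V) : ℝ≥0∞ := ∑' _ : E, (1 : ℝ≥0∞)

/-- The average of `|f|` over a set, with respect to counting measure. -/
noncomputable def setAvg (t : TreeData V) (S : Set V) (f : V → ℝ) : ℝ≥0∞ :=
  (∑' y : S, (‖f y‖₊ : ℝ≥0∞)) / (S.ncard : ℝ≥0∞)

/-- The centred triangular maximal operator `𝒯`. -/
noncomputable def cmax (t : TreeData V) (f : V → ℝ) (x : V) : ℝ≥0∞ :=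
  ⨆ R : ℕ, t.setAvg (t.tri x R) f

/-- The uncentred triangular maximal operator `𝒰`. -/
noncomputable def umax (t : TreeData V) (f : V → ℝ) (x : V) : ℝ≥0∞ :=
  ⨆ (v : V) (R : ℕ) (_ : x ∈ t.tri v R), t.setAvg (t.tri v R) f

/-- The uncentred base maximal operator `ℬᵘ`. -/
noncomputable def ubmax (t : TreeData V) (f : V → ℝ) (x : V) : ℝ≥0∞ :=
  ⨆ (v : V) (R : ℕ) (_ : x ∈ t.tri v R), t.setAvg (t.base v R) f

/-- The modified triangle `T'_r(x) = T_r(x) ∪ {p^r(x)}`. -/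
def mtri (t : TreeData V) (x : V) (r : ℕ) : Set V := t.tri x r ∪ {t.pred^[r] x}

/-- The modified centred triangular maximal operator `𝒯'`. -/
noncomputable def cmax' (t : TreeData V) (f : V → ℝ) (x : V) : ℝ≥0∞ :=
  ⨆ r : ℕ, t.setAvg (t.mtri x r) f

/-- The modified uncentred triangular maximal operator `𝒰'`. -/
noncomputable def umax' (t : TreeData V) (f : V → ℝ) (x : V) : ℝ≥0∞ :=
  ⨆ (v : V) (r : ℕ) (_ : x ∈ t.mtri v r), t.setAvg (t.mtri v r) f

/-- The `ℓ^p` norm with respect to counting measure, for `p ∈ [1,∞]`. -/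
noncomputable def eLp (p : ℝ≥0∞) (g : V → ℝ≥0∞) : ℝ≥0∞ :=
  if p = ∞ then ⨆ v, g v else (∑' v, g v ^ p.toReal) ^ (1 / p.toReal)

/-- `|f|` as an `ℝ≥0∞`-valued function. -/
noncomputable def nn (f : V → ℝ) (x : V) : ℝ≥0∞ := (‖f x‖₊ : ℝ≥0∞)

/-- The point mass at `o`. -/
noncomputable def delta (o : V) : V → ℝ := ({o} : Set V).indicator fun _ => 1

end TreeData

namespace TreeData

section Combinatorics

variable {V : Type*} (t : TreeData V)

lemma base_finite (x : V) (n : ℕ) : (t.base x n).Finite := by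
  induction n generalizing x with
  | zero => simp [base]
  | succ n ih =>
    refine ((t.fiber_finite x).biUnion fun z _ => ih z).subset fun y hy => ?_
    rw [base, Set.mem_ofPred_eq, Function.iterate_succ_apply'] at hy
    exact Set.mem_biUnion (x := t.pred^[n] y) hy rfl

lemma tri_finite (v : V) (R : ℕ) : (t.tri v R).Finite := by
  refine ((Set.finite_Iic R).biUnion fun j _ => t.base_finite v j).subset ?_
  rintro y ⟨j, hj, hy⟩
  exact Set.mem_biUnion (x := j) hj hy

lemma ht_iterate (x : V) (n : ℕ) : t.ht (t.pred^[n] x) = t.ht x + n := by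
  induction n with
  | zero => simp
  | succ n ih => rw [Function.iterate_succ_apply', t.ht_pred, ih]; push_cast; ring

variable {t}

lemma Thick.two_pow_le_ncard_base (hthick : t.Thick) (x : V) (n : ℕ) :
    2 ^ n ≤ (t.base x n).ncard := by
  induction n with
  | zero => simp [base]
  | succ n ih =>
    classical
    set A := (t.base_finite x n).toFinset with hA
    set B := (t.base_finite x (n + 1)).toFinset with hB
    have hmaps : ∀ y ∈ B, t.pred y ∈ A := by
      intro y hy
      simpa [hA, hB, base, Function.iterate_succ_apply] using hy
    have hfib : ∀ a ∈ A, 2 ≤ (B.filter fun y => t.pred y = a).card := by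
      intro a ha
      refine (hthick a).trans (le_of_eq ?_)
      rw [← Set.ncard_coe_finset]
      congr 1
      ext y
      simp only [succs, Set.mem_ofPred_eq, Finset.coe_filter, iff_and_self]
      rintro rfl
      simpa [hA, hB, base, Function.iterate_succ_apply] using ha
    have h1 := Finset.card_nsmul_le_sum A _ 2 hfib
    rw [← Finset.card_eq_sum_card_fiberwise hmaps] at h1
    rw [Set.ncard_eq_toFinset_card _ (t.base_finite x n), ← hA] at ih
    rw [Set.ncard_eq_toFinset_card _ (t.base_finite x (n + 1)), ← hB]
    simp only [smul_eq_mul] at h1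
    rw [pow_succ]
    linarith

lemma tri_subset_tri_of_iterate {x v v' : V} {R R' j j' : ℕ} (hj : t.pred^[j] x = v)
    (hj' : t.pred^[j'] x = v') (hjj : j ≤ j') (hR : R + j' ≤ R' + j) :
    t.tri v R ⊆ t.tri v' R' := by
  rintro y ⟨i, hi, hy⟩
  refine ⟨j' - j + i, by omega, ?_⟩
  rw [Function.iterate_add_apply, hy, ← hj, ← Function.iterate_add_apply,
    Nat.sub_add_cancel hjj, hj']

/-- A point lying in `k` pairwise non-nested triangles has all its descendants of generation
`k - 1` in one of them. -/
lemma exists_base_subset_tri (P : Finset (V × ℕ))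
    (hP : ∀ a ∈ P, ∀ b ∈ P, t.tri a.1 a.2 ⊆ t.tri b.1 b.2 → a = b)
    (x : V) (Q : Finset (V × ℕ)) (hQP : Q ⊆ P) (hQ : ∀ a ∈ Q, x ∈ t.tri a.1 a.2)
    (hne : Q.Nonempty) :
    ∃ a ∈ Q, t.base x (Q.card - 1) ⊆ t.tri a.1 a.2 := by
  have hQ' : ∀ a : V × ℕ, ∃ j, a ∈ Q → j ≤ a.2 ∧ t.pred^[j] x = a.1 := by
    intro a
    by_cases ha : a ∈ Q
    · obtain ⟨j, hj⟩ := hQ a ha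
      exact ⟨j, fun _ => hj⟩
    · exact ⟨0, fun h => absurd h ha⟩
  choose j hj using hQ'
  have key : ∃ a ∈ Q, Q.card - 1 ≤ a.2 - j a := by
    by_contra! hcon
    have hinj : Set.InjOn (fun a : V × ℕ => a.2 - j a) (Q : Set (V × ℕ)) := by
      intro a ha b hb hab
      obtain ⟨ha1, ha2⟩ := hj a ha
      obtain ⟨hb1, hb2⟩ := hj b hb
      simp only at hab
      rcases le_total (j a) (j b) with h | h
      · exact hP a (hQP ha) b (hQP hb) (tri_subset_tri_of_iterate ha2 hb2 h (by omega))
      · exact (hP b (hQP hb) a (hQP ha) (tri_subset_tri_of_iterate hb2 ha2 h (by omega))).symm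
    have hle := Finset.card_le_card_of_injOn (t := Finset.range (Q.card - 1)) _
      (fun a ha => by simpa using hcon a ha) hinj
    have := hne.card_pos
    simp at hle
    omega
  obtain ⟨a, ha, hle⟩ := key
  refine ⟨a, ha, fun y hy => ⟨Q.card - 1 + j a, ?_, ?_⟩⟩
  · have := (hj a ha).1
    omega
  · rw [add_comm, Function.iterate_add_apply, show t.pred^[Q.card - 1] y = x from hy, (hj a ha).2]

/-- A finite set of points covered by finitely many triangles is covered by a pairwise non-nested
subfamily. -/
lemma exists_nonnested_cover (P : Finset (V × ℕ)) (K : Finset V)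
    (hK : ∀ x ∈ K, ∃ a ∈ P, x ∈ t.tri a.1 a.2) :
    ∃ P' ⊆ P, (∀ x ∈ K, ∃ a ∈ P', x ∈ t.tri a.1 a.2) ∧
      ∀ a ∈ P', ∀ b ∈ P', t.tri a.1 a.2 ⊆ t.tri b.1 b.2 → a = b := by
  classical
  obtain ⟨P', hle, hmin⟩ := exists_minimal_le_of_wellFoundedLT
    (fun P : Finset (V × ℕ) => ∀ x ∈ K, ∃ a ∈ P, x ∈ t.tri a.1 a.2) P hK
  refine ⟨P', hle, hmin.prop, fun a ha b hb hab => ?_⟩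
  by_contra hne
  have hcov : ∀ x ∈ K, ∃ c ∈ P'.erase a, x ∈ t.tri c.1 c.2 := by
    intro x hx
    obtain ⟨c, hc, hxc⟩ := hmin.prop x hx
    by_cases hca : c = a
    · exact ⟨b, Finset.mem_erase.2 ⟨fun h => hne h.symm, hb⟩, hab (hca ▸ hxc)⟩
    · exact ⟨c, Finset.mem_erase.2 ⟨hca, hc⟩, hxc⟩
  exact Finset.notMem_erase a P' (hmin.le_of_le hcov (Finset.erase_subset a P') ha)

open Classical in
/-- The overlap function of a pairwise non-nested family of triangles has exponentially decaying
distribution. -/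
lemma Thick.two_pow_mul_card_overlap_le (hthick : t.Thick) (P : Finset (V × ℕ))
    (hP : ∀ a ∈ P, ∀ b ∈ P, t.tri a.1 a.2 ⊆ t.tri b.1 b.2 → a = b) (E : Finset V)
    (hE : ∀ y, y ∈ E ↔ ∃ a ∈ P, y ∈ t.tri a.1 a.2) (k : ℕ) :
    2 ^ k * (E.filter fun x => (P.filter fun a => x ∈ t.tri a.1 a.2).card = k + 1).card
      ≤ E.card := by
  set A := E.filter fun x => (P.filter fun a => x ∈ t.tri a.1 a.2).card = k + 1 with hA
  have hfib : ∀ x ∈ A, 2 ^ k ≤ (E.filter fun y => t.pred^[k] y = x).card := by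
    intro x hx
    have hcard := (Finset.mem_filter.1 hx).2
    obtain ⟨a, ha, hsub⟩ := exists_base_subset_tri P hP x _ (Finset.filter_subset _ _)
      (fun a ha => (Finset.mem_filter.1 ha).2) (Finset.card_pos.1 (by omega))
    rw [hcard, Nat.add_sub_cancel] at hsub
    refine (hthick.two_pow_le_ncard_base x k).trans (le_of_eq ?_)
    rw [← Set.ncard_coe_finset]
    congr 1
    ext y
    simp only [base, Set.mem_ofPred_eq, Finset.coe_filter, iff_and_self]
    intro hy
    exact (hE y).2 ⟨a, (Finset.mem_filter.1 ha).1, hsub hy⟩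
  have h1 := Finset.card_nsmul_le_sum A _ _ hfib
  have h2 : ∑ x ∈ A, (E.filter fun y => t.pred^[k] y = x).card ≤ E.card := by
    convert! (Finset.sum_card_fiberwise_eq_card_filter E A t.pred^[k]).trans_le
      (Finset.card_filter_le _ _)
  rw [smul_eq_mul, mul_comm] at h1
  exact h1.trans h2

end Combinatorics

section WeakType

variable {V : Type*} {t : TreeData V}

open Classical in
lemma Thick.sum_overlap_rpow_le (hthick : t.Thick) (P : Finset (V × ℕ))
    (hP : ∀ a ∈ P, ∀ b ∈ P, t.tri a.1 a.2 ⊆ t.tri b.1 b.2 → a = b) (E : Finset V)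
    (hE : ∀ y, y ∈ E ↔ ∃ a ∈ P, y ∈ t.tri a.1 a.2) {q : ℝ} (hq : 0 < q) :
    ∑ x ∈ E, ((P.filter fun a => x ∈ t.tri a.1 a.2).card : ℝ≥0∞) ^ q ≤
      2 * (∑' k : ℕ, (k : ℝ≥0∞) ^ q * (2 : ℝ≥0∞) ^ (-(k : ℤ))) * E.card := by
  set N : V → ℕ := fun x => (P.filter fun a => x ∈ t.tri a.1 a.2).card with hN
  have hmaps : ∀ x ∈ E, N x ∈ Finset.range (P.card + 1) := fun x _ =>
    Finset.mem_range.2 (Nat.lt_succ_of_le (Finset.card_filter_le _ _))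
  have hterm : ∀ k : ℕ, ∑ x ∈ E.filter (fun x => N x = k), (N x : ℝ≥0∞) ^ q ≤
      (k : ℝ≥0∞) ^ q * (2 : ℝ≥0∞) ^ (-(k : ℤ)) * (2 * E.card) := by
    intro k
    have hsum : ∑ x ∈ E.filter (fun x => N x = k), (N x : ℝ≥0∞) ^ q =
        (E.filter (fun x => N x = k)).card * (k : ℝ≥0∞) ^ q := by
      rw [Finset.sum_congr rfl (g := fun _ => (k : ℝ≥0∞) ^ q), Finset.sum_const, nsmul_eq_mul]
      intro x hx
      rw [(Finset.mem_filter.1 hx).2]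
    rw [hsum]
    cases k with
    | zero => simp [ENNReal.zero_rpow_of_pos hq]
    | succ k =>
      have h := hthick.two_pow_mul_card_overlap_le P hP E hE k
      have h2 : ((E.filter (fun x => N x = k + 1)).card : ℝ≥0∞) ≤
          (2 : ℝ≥0∞) ^ (-((k + 1 : ℕ) : ℤ)) * (2 * E.card) := by
        rw [ENNReal.zpow_neg, zpow_natCast, mul_comm, ← div_eq_mul_inv,
          ENNReal.le_div_iff_mul_le (by simp) (by simp)]
        have h3 : ((2 ^ k * (E.filter (fun x => N x = k + 1)).card : ℕ) : ℝ≥0∞) ≤ (E.card : ℕ) :=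
          Nat.cast_le.2 h
        push_cast at h3
        calc ((E.filter (fun x => N x = k + 1)).card : ℝ≥0∞) * 2 ^ (k + 1)
            = 2 * (2 ^ k * (E.filter (fun x => N x = k + 1)).card) := by ring
          _ ≤ _ := by gcongr
      calc _ ≤ ((2 : ℝ≥0∞) ^ (-((k + 1 : ℕ) : ℤ)) * (2 * E.card)) * ((k + 1 : ℕ) : ℝ≥0∞) ^ q := by
            gcongr
        _ = _ := by ring
  calc ∑ x ∈ E, (N x : ℝ≥0∞) ^ q
      = ∑ k ∈ Finset.range (P.card + 1), ∑ x ∈ E.filter (fun x => N x = k), (N x : ℝ≥0∞) ^ q :=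
        (Finset.sum_fiberwise_of_maps_to hmaps _).symm
    _ ≤ ∑ k ∈ Finset.range (P.card + 1),
          (k : ℝ≥0∞) ^ q * (2 : ℝ≥0∞) ^ (-(k : ℤ)) * (2 * E.card) :=
        Finset.sum_le_sum fun k _ => hterm k
    _ = (∑ k ∈ Finset.range (P.card + 1), (k : ℝ≥0∞) ^ q * (2 : ℝ≥0∞) ^ (-(k : ℤ)))
          * (2 * E.card) := by rw [Finset.sum_mul]
    _ ≤ (∑' k : ℕ, (k : ℝ≥0∞) ^ q * (2 : ℝ≥0∞) ^ (-(k : ℤ))) * (2 * E.card) := by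
        gcongr
        exact ENNReal.sum_le_tsum _
    _ = _ := by ring

lemma mul_card_tri_le_sum {f : V → ℝ} {α : ℝ≥0∞} {v : V} {R : ℕ} (E : Finset V)
    (hE : (E : Set V) = t.tri v R) (h : α < t.setAvg (t.tri v R) f) :
    α * E.card ≤ ∑ y ∈ E, nn f y := by
  rw [setAvg, ← hE, Set.ncard_coe_finset] at h
  have h1 := ENNReal.mul_le_of_le_div h.le
  rwa [Finset.tsum_subtype' E (fun y => (‖f y‖₊ : ℝ≥0∞))] at h1

/-- Cancelling the measure of the level set after Hölder's inequality. -/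
lemma mul_le_of_mul_le_holder {p q : ℝ} (hpq : p.HolderConjugate q) {α e F S : ℝ≥0∞}
    (he : e ≠ ∞) (h : α * e ≤ F ^ (1 / p) * (S * e) ^ (1 / q)) :
    α ^ p * e ≤ S ^ (p / q) * F := by
  rcases eq_or_ne e 0 with rfl | h0
  · simp
  have hp := hpq.pos
  have hq := hpq.symm.pos
  have h1 := ENNReal.rpow_le_rpow h hp.le
  rw [ENNReal.mul_rpow_of_nonneg _ _ hp.le, ENNReal.mul_rpow_of_nonneg _ _ hp.le,
    ← ENNReal.rpow_mul, ← ENNReal.rpow_mul, one_div_mul_cancel hp.ne', ENNReal.rpow_one,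
    one_div_mul_eq_div, ENNReal.mul_rpow_of_nonneg _ _ (by positivity)] at h1
  have hpe : p = 1 + p / q := by
    have := hpq.inv_add_inv_eq_one
    field_simp at this ⊢
    linarith
  have h2 : e ^ p = e * e ^ (p / q) := by
    conv_lhs => rw [hpe, ENNReal.rpow_add _ _ h0 he, ENNReal.rpow_one]
  have h3 : e ^ (p / q) ≠ 0 := (ENNReal.rpow_pos (pos_iff_ne_zero.2 h0) he).ne'
  have h4 : e ^ (p / q) ≠ ∞ := ENNReal.rpow_ne_top_of_nonneg (by positivity) he
  rw [h2] at h1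
  refine (ENNReal.mul_le_mul_iff_left h3 h4).1 ?_
  calc _ = α ^ p * (e * e ^ (p / q)) := by ring
    _ ≤ _ := h1
    _ = _ := by ring

lemma Thick.card_mul_le (hthick : t.Thick) {p q : ℝ} (hpq : p.HolderConjugate q) (f : V → ℝ)
    (α : ℝ≥0∞) (K : Finset V) (hK : ∀ x ∈ K, α < t.umax f x) :
    α ^ p * K.card ≤
      (2 * ∑' k : ℕ, (k : ℝ≥0∞) ^ q * (2 : ℝ≥0∞) ^ (-(k : ℤ))) ^ (p / q) *
        ∑' x, nn f x ^ p := by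
  classical
  have hsel : ∀ x : V, ∃ a : V × ℕ, x ∈ K →
      x ∈ t.tri a.1 a.2 ∧ α < t.setAvg (t.tri a.1 a.2) f := by
    intro x
    by_cases hx : x ∈ K
    · have h := hK x hx
      simp only [umax, lt_iSup_iff] at h
      obtain ⟨v, R, hm, hlt⟩ := h
      exact ⟨(v, R), fun _ => ⟨hm, hlt⟩⟩
    · exact ⟨(x, 0), fun h => absurd h hx⟩
  choose c hc using hsel
  obtain ⟨P, hPsub, hcov, hP⟩ := exists_nonnested_cover (t := t) (K.image c) K
    (fun x hx => ⟨c x, Finset.mem_image_of_mem c hx, (hc x hx).1⟩)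
  have havg : ∀ a ∈ P, α < t.setAvg (t.tri a.1 a.2) f := by
    intro a ha
    obtain ⟨x, hx, rfl⟩ := Finset.mem_image.1 (hPsub ha)
    exact (hc x hx).2
  set T : V × ℕ → Finset V := fun a => (t.tri_finite a.1 a.2).toFinset with hT
  set E : Finset V := P.biUnion T with hEdef
  have hE : ∀ y, y ∈ E ↔ ∃ a ∈ P, y ∈ t.tri a.1 a.2 := by simp [hEdef, hT]
  have hKE : K ⊆ E := fun x hx => (hE x).2 (hcov x hx)
  have hTE : ∀ a ∈ P, T a ⊆ E := fun a ha => Finset.subset_biUnion_of_mem T ha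
  have hswap : ∑ a ∈ P, ∑ y ∈ T a, nn f y =
      ∑ y ∈ E, nn f y * ((P.filter fun a => y ∈ t.tri a.1 a.2).card : ℝ≥0∞) := by
    have h1 : ∀ a ∈ P, ∑ y ∈ T a, nn f y =
        ∑ y ∈ E, if y ∈ t.tri a.1 a.2 then nn f y else 0 := by
      intro a ha
      rw [← Finset.sum_filter]
      refine Finset.sum_congr ?_ fun _ _ => rfl
      ext y
      have := @hTE a ha y
      simp only [hT, Set.Finite.mem_toFinset, Finset.mem_filter] at this ⊢
      tauto
    rw [Finset.sum_congr rfl h1, Finset.sum_comm]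
    refine Finset.sum_congr rfl fun y _ => ?_
    rw [← Finset.sum_filter, Finset.sum_const, nsmul_eq_mul, mul_comm]
  have hmain : α * E.card ≤ (∑' x, nn f x ^ p) ^ (1 / p) *
      ((2 * ∑' k : ℕ, (k : ℝ≥0∞) ^ q * (2 : ℝ≥0∞) ^ (-(k : ℤ))) * E.card) ^ (1 / q) :=
    calc α * (E.card : ℝ≥0∞) ≤ α * ((∑ a ∈ P, (T a).card : ℕ) : ℝ≥0∞) := by
          gcongr
          exact Finset.card_biUnion_le
      _ = ∑ a ∈ P, α * ((T a).card : ℝ≥0∞) := by rw [Nat.cast_sum, Finset.mul_sum]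
      _ ≤ ∑ a ∈ P, ∑ y ∈ T a, nn f y := Finset.sum_le_sum fun a ha =>
          mul_card_tri_le_sum (T a) (by simp [hT]) (havg a ha)
      _ = _ := hswap
      _ ≤ _ := ENNReal.inner_le_Lp_mul_Lq _ _ _ hpq
      _ ≤ _ := by
          gcongr
          · exact one_div_nonneg.2 hpq.pos.le
          · exact ENNReal.sum_le_tsum _
          · exact one_div_nonneg.2 hpq.symm.pos.le
          · exact hthick.sum_overlap_rpow_le P hP E hE hpq.symm.pos
  calc α ^ p * (K.card : ℝ≥0∞) ≤ α ^ p * E.card := by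
        gcongr
    _ ≤ _ := mul_le_of_mul_le_holder hpq (ENNReal.natCast_ne_top _) hmain

lemma Thick.mul_esize_le (hthick : t.Thick) {p q : ℝ} (hpq : p.HolderConjugate q) (f : V → ℝ)
    (α : ℝ≥0∞) :
    α ^ p * esize {x | α < t.umax f x} ≤
      (2 * ∑' k : ℕ, (k : ℝ≥0∞) ^ q * (2 : ℝ≥0∞) ^ (-(k : ℤ))) ^ (p / q) *
        ∑' x, nn f x ^ p := by
  rw [esize, ENNReal.tsum_eq_iSup_sum, ENNReal.mul_iSup]
  refine iSup_le fun K => ?_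
  have h := hthick.card_mul_le hpq f α (K.map (Function.Embedding.subtype _))
    (by simp only [Finset.mem_map]; rintro x ⟨y, -, rfl⟩; exact y.2)
  simpa using h

end WeakType

section Dyadic

lemma rpow_le_mul_tsum_dyadic {p : ℝ} (hp : 0 < p) (g : ℝ≥0∞) :
    g ^ p ≤ 4 ^ p * ∑' n : ℤ, if 2 * (2 : ℝ≥0∞) ^ n < g then ((2 : ℝ≥0∞) ^ n) ^ p else 0 := by
  rcases eq_or_ne g 0 with rfl | h0
  · simp [ENNReal.zero_rpow_of_pos hp]
  rcases eq_or_ne g ∞ with rfl | htop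
  · have h1 : (∑' _ : ℕ, (1 : ℝ≥0∞)) ≤
        ∑' n : ℤ, if 2 * (2 : ℝ≥0∞) ^ n < ∞ then ((2 : ℝ≥0∞) ^ n) ^ p else 0 := by
      refine le_trans (ENNReal.tsum_le_tsum fun n : ℕ => ?_)
        (ENNReal.tsum_comp_le_tsum_of_injective (f := fun n : ℕ => (n : ℤ)) Nat.cast_injective _)
      have hlt : 2 * (2 : ℝ≥0∞) ^ (n : ℤ) < ∞ :=
        ENNReal.mul_lt_top (by simp) (by rw [zpow_natCast]; exact ENNReal.pow_lt_top (by simp))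
      simp only [hlt, if_true]
      rw [zpow_natCast]
      exact ENNReal.one_le_rpow (one_le_pow₀ one_le_two) hp
    rw [ENNReal.tsum_const_eq_top_of_ne_zero one_ne_zero, top_le_iff] at h1
    rw [h1, ENNReal.mul_top (ENNReal.rpow_pos (by simp) (by simp)).ne']
    exact le_top
  · obtain ⟨m, hm1, hm2⟩ := ENNReal.exists_mem_Ioc_zpow h0 htop ENNReal.one_lt_two
      ENNReal.ofNat_ne_top
    have hm : 2 * (2 : ℝ≥0∞) ^ (m - 1) = 2 ^ m := by
      rw [← add_sub_cancel 1 m, ENNReal.zpow_add (by simp) (by simp), zpow_one,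
        add_sub_cancel_left]
    have hm' : (2 : ℝ≥0∞) ^ (m + 1) = 4 * 2 ^ (m - 1) := by
      rw [ENNReal.zpow_add (by simp) (by simp), zpow_one, ← hm]
      ring
    calc g ^ p ≤ (4 * (2 : ℝ≥0∞) ^ (m - 1)) ^ p := by
          rw [← hm']
          gcongr
      _ = 4 ^ p * ((2 : ℝ≥0∞) ^ (m - 1)) ^ p := ENNReal.mul_rpow_of_nonneg _ _ hp.le
      _ ≤ _ := by
          gcongr
          refine le_trans ?_ (ENNReal.le_tsum (m - 1))
          rw [if_pos (hm ▸ hm1)]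

lemma tsum_dyadic_le {s : ℝ} (hs : 0 < s) {g : ℝ≥0∞} (hg : g ≠ ∞) :
    (∑' n : ℤ, if (2 : ℝ≥0∞) ^ n < g then ((2 : ℝ≥0∞) ^ n) ^ s else 0) ≤
      (1 - ((2 : ℝ≥0∞) ^ s)⁻¹)⁻¹ * g ^ s := by
  rcases eq_or_ne g 0 with rfl | h0
  · simp
  obtain ⟨m, hm1, hm2⟩ := ENNReal.exists_mem_Ioc_zpow h0 hg ENNReal.one_lt_two
    ENNReal.ofNat_ne_top
  have hinj : Function.Injective fun k : ℕ => m - (k : ℤ) := fun a b hab => by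
    simpa using hab
  rw [← hinj.tsum_eq, ← ENNReal.tsum_geometric, mul_comm, ← ENNReal.tsum_mul_left]
  · refine ENNReal.tsum_le_tsum fun k => ?_
    split_ifs
    · rw [ENNReal.zpow_sub (by simp) (by simp), zpow_natCast,
        ENNReal.mul_rpow_of_nonneg _ _ hs.le, ENNReal.inv_rpow, ← ENNReal.inv_pow,
        ← ENNReal.rpow_natCast, ← ENNReal.rpow_natCast, ← ENNReal.rpow_mul, ← ENNReal.rpow_mul,
        mul_comm s]
      gcongr
    · exact zero_le
  · intro n hn
    rw [Function.mem_support] at hn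
    have hlt : (2 : ℝ≥0∞) ^ n < 2 ^ (m + 1) := by
      by_contra hcon
      exact hn (if_neg fun h => hcon (h.trans_le hm2))
    have hnm : n ≤ m := by
      by_contra hcon
      exact absurd hlt (not_lt.2 (ENNReal.zpow_le_of_le ENNReal.one_lt_two.le (by omega)))
    exact ⟨(m - n).toNat, by simp only; omega⟩

lemma tsum_rpow_mul_two_zpow_neg_lt_top {q : ℝ} (hq : 0 < q) :
    (∑' k : ℕ, (k : ℝ≥0∞) ^ q * (2 : ℝ≥0∞) ^ (-(k : ℤ))) < ∞ := by
  obtain ⟨N, hN⟩ := exists_nat_ge q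
  have hsum : Summable fun k : ℕ => (k : ℝ) ^ N * (1 / 2 : ℝ) ^ k :=
    summable_pow_mul_geometric_of_norm_lt_one N (by norm_num)
  have hle : ∀ k : ℕ, (k : ℝ≥0∞) ^ q * (2 : ℝ≥0∞) ^ (-(k : ℤ)) ≤
      ENNReal.ofReal ((k : ℝ) ^ N * (1 / 2 : ℝ) ^ k) := by
    intro k
    rw [ENNReal.ofReal_mul (by positivity), ENNReal.ofReal_pow (by positivity),
      ENNReal.ofReal_pow (by positivity), ENNReal.ofReal_natCast, ENNReal.zpow_neg, zpow_natCast,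
      one_div, ENNReal.ofReal_inv_of_pos two_pos, ENNReal.ofReal_ofNat, ENNReal.inv_pow]
    gcongr
    rcases Nat.eq_zero_or_pos k with rfl | hk
    · simp [ENNReal.zero_rpow_of_pos hq]
    · rw [← ENNReal.rpow_natCast]
      exact ENNReal.rpow_le_rpow_of_exponent_le (by exact_mod_cast hk) hN
  refine (ENNReal.tsum_le_tsum hle).trans_lt ?_
  rw [← ENNReal.ofReal_tsum_of_nonneg (fun k => by positivity) hsum]
  exact ENNReal.ofReal_lt_top

end Dyadic

section StrongType

variable {V : Type*} {t : TreeData V}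

lemma setAvg_le_setAvg_add {f h : V → ℝ} {β : ℝ≥0∞} (hfh : ∀ x, nn f x ≤ nn h x + β)
    {S : Set V} (hS : S.Finite) : t.setAvg S f ≤ t.setAvg S h + β := by
  lift S to Finset V using hS
  rw [setAvg, setAvg, Set.ncard_coe_finset, Finset.tsum_subtype' S (fun y => (‖f y‖₊ : ℝ≥0∞)),
    Finset.tsum_subtype' S (fun y => (‖h y‖₊ : ℝ≥0∞))]
  calc _ ≤ (∑ y ∈ S, ((‖h y‖₊ : ℝ≥0∞) + β)) / (S.card : ℝ≥0∞) := by
        gcongr with y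
        exact hfh y
    _ = (∑ y ∈ S, (‖h y‖₊ : ℝ≥0∞)) / (S.card : ℝ≥0∞) + (S.card * β) / (S.card : ℝ≥0∞) := by
        rw [Finset.sum_add_distrib, Finset.sum_const, nsmul_eq_mul, ENNReal.add_div]
    _ ≤ _ := by
        gcongr
        exact ENNReal.div_le_of_le_mul (mul_comm _ _).le

lemma umax_le_umax_add {f h : V → ℝ} {β : ℝ≥0∞} (hfh : ∀ x, nn f x ≤ nn h x + β) (x : V) :
    t.umax f x ≤ t.umax h x + β := by
  refine iSup_le fun v => iSup_le fun R => iSup_le fun hx => ?_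
  refine (setAvg_le_setAvg_add hfh (t.tri_finite v R)).trans ?_
  gcongr
  exact le_iSup_of_le v (le_iSup_of_le R (le_iSup_of_le hx le_rfl))

lemma umax_zero (x : V) : t.umax (fun _ => 0) x = 0 := by
  simp [umax, setAvg]

/-- A weak-type `(r, r)` estimate for the large part of `f`, which controls the level sets of
the maximal function. -/
lemma Thick.mul_esize_le_tsum_large (hthick : t.Thick) {r q : ℝ} (hrq : r.HolderConjugate q)
    (f : V → ℝ) {β : ℝ≥0∞} (hβ : β ≠ ∞) :
    β ^ r * esize {x | 2 * β < t.umax f x} ≤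
      (2 * ∑' k : ℕ, (k : ℝ≥0∞) ^ q * (2 : ℝ≥0∞) ^ (-(k : ℤ))) ^ (r / q) *
        ∑' x, if β < nn f x then nn f x ^ r else 0 := by
  classical
  set h : V → ℝ := fun x => if β < nn f x then f x else 0 with hh
  have hfh : ∀ x, nn f x ≤ nn h x + β := by
    intro x
    by_cases hx : β < nn f x
    · simp [nn, hh] at hx ⊢
      simp [hx]
    · exact (not_lt.1 hx).trans le_add_self
  have hsub : {x | 2 * β < t.umax f x} ⊆ {x | β < t.umax h x} := by
    intro x hx
    have h1 : 2 * β < t.umax h x + β := lt_of_lt_of_le hx (umax_le_umax_add hfh x)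
    rw [two_mul] at h1
    exact (ENNReal.add_lt_add_iff_right hβ).1 h1
  have hpow : ∀ x, nn h x ^ r = if β < nn f x then nn f x ^ r else 0 := by
    intro x
    by_cases hx : β < nn f x
    · simp only [hx, if_true]
      simp only [nn] at hx ⊢
      simp [hh, nn, hx]
    · simp only [hx, if_false]
      simp only [nn] at hx ⊢
      simp [hh, nn, hx, hrq.pos]
  simp only [← hpow]
  refine le_trans ?_ (hthick.mul_esize_le hrq h β)
  gcongr
  exact ENNReal.tsum_mono_subtype (fun _ => 1) hsub

lemma esize_eq_tsum (E : Set V) [DecidablePred (· ∈ E)] :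
    esize E = ∑' x, if x ∈ E then 1 else 0 := by
  rw [esize, tsum_subtype E (fun _ => (1 : ℝ≥0∞))]
  congr with x
  simp [Set.indicator_apply]

lemma Thick.exists_tsum_umax_rpow_le (hthick : t.Thick) {p : ℝ} (hp : 1 < p) :
    ∃ C : ℝ≥0∞, C ≠ ∞ ∧ ∀ f : V → ℝ, ∑' x, t.umax f x ^ p ≤ C * ∑' x, nn f x ^ p := by
  classical
  obtain ⟨r, hr1, hrp⟩ := exists_between hp
  have hrq : r.HolderConjugate (r / (r - 1)) := Real.HolderConjugate.conjExponent hr1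
  set q := r / (r - 1)
  set A : ℝ≥0∞ := (2 * ∑' k : ℕ, (k : ℝ≥0∞) ^ q * (2 : ℝ≥0∞) ^ (-(k : ℤ))) ^ (r / q) with hA
  set B : ℝ≥0∞ := (1 - ((2 : ℝ≥0∞) ^ (p - r))⁻¹)⁻¹ with hB
  have hAtop : A ≠ ∞ := ENNReal.rpow_ne_top_of_nonneg
    (div_nonneg hrq.pos.le hrq.symm.pos.le)
    (ENNReal.mul_ne_top (by simp) (tsum_rpow_mul_two_zpow_neg_lt_top hrq.symm.pos).ne)
  have hBtop : B ≠ ∞ := by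
    rw [hB, ENNReal.inv_ne_top, ne_eq, tsub_eq_zero_iff_le, not_le, ENNReal.inv_lt_one]
    exact ENNReal.one_lt_rpow ENNReal.one_lt_two (by linarith)
  refine ⟨4 ^ p * (A * B), ENNReal.mul_ne_top (ENNReal.rpow_ne_top_of_nonneg (by linarith)
    (by simp)) (ENNReal.mul_ne_top hAtop hBtop), fun f => ?_⟩
  have h2pos : ∀ n : ℤ, (2 : ℝ≥0∞) ^ n ≠ 0 := fun n => (ENNReal.zpow_pos (by simp) (by simp) n).ne'
  have h2top : ∀ n : ℤ, (2 : ℝ≥0∞) ^ n ≠ ∞ :=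
    fun n => (ENNReal.zpow_lt_top (by simp) (by simp) n).ne
  have hsplit : ∀ n : ℤ, ((2 : ℝ≥0∞) ^ n) ^ p = ((2 : ℝ≥0∞) ^ n) ^ (p - r) * (2 ^ n) ^ r := by
    intro n
    rw [← ENNReal.rpow_add _ _ (h2pos n) (h2top n), sub_add_cancel]
  have hlevel : ∀ n : ℤ,
      (∑' x, if 2 * (2 : ℝ≥0∞) ^ n < t.umax f x then ((2 : ℝ≥0∞) ^ n) ^ p else 0) ≤
        A * ∑' x, (if (2 : ℝ≥0∞) ^ n < nn f x then ((2 : ℝ≥0∞) ^ n) ^ (p - r) else 0) *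
          nn f x ^ r := by
    intro n
    calc (∑' x, if 2 * (2 : ℝ≥0∞) ^ n < t.umax f x then ((2 : ℝ≥0∞) ^ n) ^ p else 0)
        = ((2 : ℝ≥0∞) ^ n) ^ p * esize {x | 2 * (2 : ℝ≥0∞) ^ n < t.umax f x} := by
          rw [esize_eq_tsum, ← ENNReal.tsum_mul_left]
          simp
      _ = ((2 : ℝ≥0∞) ^ n) ^ (p - r) *
            ((2 ^ n) ^ r * esize {x | 2 * (2 : ℝ≥0∞) ^ n < t.umax f x}) := by
          rw [hsplit, mul_assoc]
      _ ≤ ((2 : ℝ≥0∞) ^ n) ^ (p - r) *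
            (A * ∑' x, if (2 : ℝ≥0∞) ^ n < nn f x then nn f x ^ r else 0) := by
          exact mul_le_mul_right (hthick.mul_esize_le_tsum_large hrq f (h2top n)) _
      _ = _ := by
          rw [mul_left_comm, ← ENNReal.tsum_mul_left]
          simp
  calc ∑' x, t.umax f x ^ p
      ≤ ∑' x, 4 ^ p * ∑' n : ℤ,
          if 2 * (2 : ℝ≥0∞) ^ n < t.umax f x then ((2 : ℝ≥0∞) ^ n) ^ p else 0 :=
        ENNReal.tsum_le_tsum fun x => rpow_le_mul_tsum_dyadic (by linarith) _
    _ = 4 ^ p * ∑' n : ℤ, ∑' x,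
          if 2 * (2 : ℝ≥0∞) ^ n < t.umax f x then ((2 : ℝ≥0∞) ^ n) ^ p else 0 := by
        rw [ENNReal.tsum_mul_left, ENNReal.tsum_comm]
    _ ≤ 4 ^ p * ∑' n : ℤ, A * ∑' x,
          (if (2 : ℝ≥0∞) ^ n < nn f x then ((2 : ℝ≥0∞) ^ n) ^ (p - r) else 0) * nn f x ^ r := by
        gcongr with n
        exact hlevel n
    _ = 4 ^ p * (A * ∑' x, (∑' n : ℤ,
          if (2 : ℝ≥0∞) ^ n < nn f x then ((2 : ℝ≥0∞) ^ n) ^ (p - r) else 0) * nn f x ^ r) := by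
        rw [ENNReal.tsum_mul_left, ENNReal.tsum_comm]
        simp only [ENNReal.tsum_mul_right]
    _ ≤ 4 ^ p * (A * ∑' x, (B * nn f x ^ (p - r)) * nn f x ^ r) := by
        gcongr with x
        exact tsum_dyadic_le (by linarith) ENNReal.coe_ne_top
    _ = 4 ^ p * (A * ∑' x, B * nn f x ^ p) := by
        congr! 4 with x
        rw [mul_assoc, ← ENNReal.rpow_add_of_nonneg _ _ (by linarith) (by linarith),
          sub_add_cancel]
    _ = _ := by rw [ENNReal.tsum_mul_left]; ring

lemma iSup_umax_le (f : V → ℝ) : ⨆ x, t.umax f x ≤ ⨆ x, nn f x := by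
  refine iSup_le fun x => ?_
  have h := umax_le_umax_add (t := t) (f := f) (h := fun _ => 0) (β := ⨆ x, nn f x)
    (fun y => (le_iSup (nn f) y).trans le_add_self) x
  rwa [umax_zero, zero_add] at h

end StrongType

end TreeData

/-- The uncentred triangular maximal operator `𝒰` satisfies the weak-type
`(p,p)` estimate `|{𝒰f > α}| ≤ A_{p'}^p ‖f‖_p^p / α^p` with
`A_{p'} = 4^{1/p'} (∑_{k≥1} k^{p'} 2^{-k})^{1/p'}`, `p' = p/(p-1)`; consequently `𝒰` is
bounded on `L^p` for every `p ∈ (1,∞]`. -/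
theorem stmt12 {V : Type*} (t : TreeData V) (hthick : t.Thick) :
    (∀ p : ℝ, 1 < p → ∀ f : V → ℝ, (∑' x, TreeData.nn f x ^ p) ≠ ∞ →
      ∀ α : ℝ≥0∞, 0 < α →
        TreeData.esize {x | α < t.umax f x} ≤
          ((4 : ℝ≥0∞) ^ (1 / (p / (p - 1))) *
              (∑' k : ℕ, (k : ℝ≥0∞) ^ (p / (p - 1)) * (2 : ℝ≥0∞) ^ (-(k : ℤ))) ^
                (1 / (p / (p - 1)))) ^ p *
            (∑' x, TreeData.nn f x ^ p) / α ^ p) ∧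
      ∀ p : ℝ≥0∞, 1 < p → ∃ C : ℝ≥0∞, C < ∞ ∧
        ∀ f : V → ℝ, TreeData.eLp p (t.umax f) ≤ C * TreeData.eLp p (TreeData.nn f) := by
  refine ⟨fun p hp f _ α hα => ?_, fun p hp => ?_⟩
  · have hpq : p.HolderConjugate (p / (p - 1)) := Real.HolderConjugate.conjExponent hp
    have hp0 := hpq.pos
    have hq0 := hpq.symm.pos
    set q := p / (p - 1)
    rcases eq_or_ne α ∞ with rfl | hαtop
    · simp [TreeData.esize]
    rw [ENNReal.le_div_iff_mul_le (Or.inl (ENNReal.rpow_pos hα hαtop).ne')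
      (Or.inl (ENNReal.rpow_ne_top_of_nonneg hp0.le hαtop)), mul_comm,
      ← ENNReal.mul_rpow_of_nonneg _ _ (one_div_nonneg.2 hq0.le), ← ENNReal.rpow_mul,
      one_div_mul_eq_div]
    refine (hthick.mul_esize_le hpq f α).trans ?_
    gcongr
    norm_num
  · rcases eq_or_ne p ∞ with rfl | hptop
    · exact ⟨1, ENNReal.one_lt_top, fun f => by
        simpa [TreeData.eLp] using TreeData.iSup_umax_le (t := t) f⟩
    · have hp1 : 1 < p.toReal := by
        rwa [← ENNReal.toReal_one, ENNReal.toReal_lt_toReal ENNReal.one_ne_top hptop]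
      obtain ⟨C, hC, h⟩ := hthick.exists_tsum_umax_rpow_le hp1
      have hinv : 0 ≤ 1 / p.toReal := by positivity
      refine ⟨C ^ (1 / p.toReal), (ENNReal.rpow_ne_top_of_nonneg hinv hC).lt_top, fun f => ?_⟩
      simp only [TreeData.eLp, if_neg hptop]
      rw [← ENNReal.mul_rpow_of_nonneg _ _ hinv]
      exact ENNReal.rpow_le_rpow (h f) hinv
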